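/- Let N = 2^n with n ≥ 1, let 0 ≤ γ < 1, and let P : Matrix (Fin N) (Fin N) ℝ satisfy uniform local dynamics. Set A := 1 − γ • P (with 1 the identity matrix). Then A is invertible, σ_min(A) > 0, and the condition number satisfies κ(A) ≤ (1+γ)/(1−γ). -/

import Mathlib

/-- Euclidean norm of a vector in ℝ^N. -/
noncomputable def euclNorm {N : ℕ} (x : Fin N → ℝ) : ℝ :=
  ‖(WithLp.equiv 2 (Fin N → ℝ)).symm x‖

/-- Largest singular value: supremum of ‖A x‖ over unit vectors x (Euclidean norm). -/
noncomputable def sigmaMax {N : ℕ} (A : Matrix (Fin N) (Fin N) ℝ) : ℝ :=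
  sSup {r : ℝ | ∃ x : Fin N → ℝ, euclNorm x = 1 ∧ r = euclNorm (A.mulVec x)}

/-- Smallest singular value: infimum of ‖A x‖ over unit vectors x (Euclidean norm). -/
noncomputable def sigmaMin {N : ℕ} (A : Matrix (Fin N) (Fin N) ℝ) : ℝ :=
  sInf {r : ℝ | ∃ x : Fin N → ℝ, euclNorm x = 1 ∧ r = euclNorm (A.mulVec x)}

theorem euclNorm_sq_eq {N : ℕ} (x : Fin N → ℝ) : euclNorm x ^ 2 = ∑ i, x i ^ 2 := by
  unfold euclNorm
  rw [EuclideanSpace.norm_sq_eq]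
  simp

theorem euclNorm_nonneg' {N : ℕ} (x : Fin N → ℝ) : 0 ≤ euclNorm x := norm_nonneg _

theorem sum_le_one_of_card {N n : ℕ} (hn : 1 ≤ n) (f : Fin N → ℝ)
    (hf : ∀ i, f i = 0 ∨ f i = 1 / n)
    (hc : (Finset.univ.filter fun i => f i ≠ 0).card ≤ n) : ∑ i, f i ≤ 1 := by
  have hn' : (0 : ℝ) < n := by exact_mod_cast hn
  rw [← Finset.sum_filter_ne_zero]
  calc ∑ i ∈ Finset.univ.filter (fun i => f i ≠ 0), f i
      = ∑ i ∈ Finset.univ.filter (fun i => f i ≠ 0), (1 / n : ℝ) := by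
        refine Finset.sum_congr rfl fun i hi => ?_
        exact (hf i).resolve_left (Finset.mem_filter.1 hi).2
    _ = ((Finset.univ.filter fun i => f i ≠ 0).card : ℝ) * (1 / n) := by simp
    _ ≤ n * (1 / n) := by
        gcongr
    _ = 1 := by field_simp

theorem euclNorm_mulVec_le {N : ℕ} (P : Matrix (Fin N) (Fin N) ℝ)
    (h0 : ∀ i j, 0 ≤ P i j) (hr : ∀ i, ∑ j, P i j ≤ 1) (hc : ∀ j, ∑ i, P i j ≤ 1)
    (x : Fin N → ℝ) : euclNorm (P.mulVec x) ≤ euclNorm x := by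
  refine (pow_le_pow_iff_left₀ (euclNorm_nonneg' _) (euclNorm_nonneg' x) two_ne_zero).1 ?_
  rw [euclNorm_sq_eq, euclNorm_sq_eq]
  calc ∑ i, (P.mulVec x i) ^ 2 ≤ ∑ i, ∑ j, P i j * x j ^ 2 := by
        refine Finset.sum_le_sum fun i _ => ?_
        have hs : 0 ≤ ∑ j, P i j * x j ^ 2 :=
          Finset.sum_nonneg fun j _ => mul_nonneg (h0 i j) (sq_nonneg _)
        have := Finset.sum_sq_le_sum_mul_sum_of_sq_eq_mul Finset.univ
          (r := fun j => P i j * x j) (f := fun j => P i j) (g := fun j => P i j * x j ^ 2)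
          (fun j _ => h0 i j) (fun j _ => mul_nonneg (h0 i j) (sq_nonneg _))
          (fun j _ => by ring)
        exact this.trans (mul_le_of_le_one_left hs (hr i))
    _ = ∑ j, (∑ i, P i j) * x j ^ 2 := by
        rw [Finset.sum_comm]
        simp only [Finset.sum_mul]
    _ ≤ ∑ j, x j ^ 2 :=
        Finset.sum_le_sum fun j _ => mul_le_of_le_one_left (sq_nonneg _) (hc j)

theorem conditionNumber_bound_uniform_local_dynamics
    (n : ℕ) (hn : 1 ≤ n) (γ : ℝ) (hγ0 : 0 ≤ γ) (hγ1 : γ < 1)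
    (P : Matrix (Fin (2 ^ n)) (Fin (2 ^ n)) ℝ)
    (hPentries : ∀ i j, P i j = 0 ∨ P i j = 1 / n)
    (hProw : ∀ i, (Finset.univ.filter fun j => P i j ≠ 0).card = n)
    (hPcol : ∀ j, (Finset.univ.filter fun i => P i j ≠ 0).card ≤ n)
    (A : Matrix (Fin (2 ^ n)) (Fin (2 ^ n)) ℝ) (hA : A = 1 - γ • P) :
    IsUnit A.det ∧ 0 < sigmaMin A ∧
      sigmaMax A / sigmaMin A ≤ (1 + γ) / (1 - γ) := by
  have hn' : (0 : ℝ) < n := by exact_mod_cast hn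
  have h0 : ∀ i j, 0 ≤ P i j := by
    intro i j
    rcases hPentries i j with h | h <;> rw [h]
    positivity
  have hP := euclNorm_mulVec_le P h0
    (fun i => sum_le_one_of_card hn _ (hPentries i) (hProw i).le)
    (fun j => sum_le_one_of_card hn _ (fun i => hPentries i j) (hPcol j))
  have hγ : 0 < 1 - γ := by linarith
  have hAx : ∀ x, WithLp.toLp 2 (A.mulVec x) = WithLp.toLp 2 x - γ • WithLp.toLp 2 (P.mulVec x) := by
    intro x
    rw [hA, Matrix.sub_mulVec, Matrix.one_mulVec, Matrix.smul_mulVec]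
    rfl
  have hsm : ∀ x : Fin (2 ^ n) → ℝ,
      ‖γ • WithLp.toLp 2 (P.mulVec x)‖ ≤ γ * euclNorm x := by
    intro x
    rw [norm_smul, Real.norm_of_nonneg hγ0]
    exact mul_le_mul_of_nonneg_left (hP x) hγ0
  have hup : ∀ x, euclNorm (A.mulVec x) ≤ (1 + γ) * euclNorm x := by
    intro x
    have h1 : euclNorm (A.mulVec x) = ‖WithLp.toLp 2 (A.mulVec x)‖ := rfl
    have h2 : euclNorm x = ‖WithLp.toLp 2 x‖ := rfl
    have h3 := norm_sub_le (WithLp.toLp 2 x) (γ • WithLp.toLp 2 (P.mulVec x))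
    have h4 := hsm x
    rw [h1, hAx]
    linarith
  have hlow : ∀ x, (1 - γ) * euclNorm x ≤ euclNorm (A.mulVec x) := by
    intro x
    have h1 : euclNorm (A.mulVec x) = ‖WithLp.toLp 2 (A.mulVec x)‖ := rfl
    have h2 : euclNorm x = ‖WithLp.toLp 2 x‖ := rfl
    have h3 := norm_sub_norm_le (WithLp.toLp 2 x) (γ • WithLp.toLp 2 (P.mulVec x))
    have h4 := hsm x
    rw [h1, hAx]
    linarith
  have hne : {r : ℝ | ∃ x : Fin (2 ^ n) → ℝ, euclNorm x = 1 ∧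
      r = euclNorm (A.mulVec x)}.Nonempty := by
    refine ⟨_, Pi.single ⟨0, by positivity⟩ 1, ?_, rfl⟩
    have h := euclNorm_sq_eq (Pi.single (⟨0, by positivity⟩ : Fin (2 ^ n)) (1 : ℝ))
    rw [Finset.sum_eq_single ⟨0, by positivity⟩ (fun b _ hb => by rw [Pi.single_eq_of_ne hb]; norm_num)
      (by simp)] at h
    rw [Pi.single_eq_same, one_pow] at h
    exact (pow_eq_one_iff_of_nonneg (euclNorm_nonneg' _) two_ne_zero).1 h
  have hmin : 1 - γ ≤ sigmaMin A := by
    refine le_csInf hne ?_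
    rintro r ⟨x, hx, rfl⟩
    simpa [hx] using hlow x
  have hmax : sigmaMax A ≤ 1 + γ := by
    refine csSup_le hne ?_
    rintro r ⟨x, hx, rfl⟩
    simpa [hx] using hup x
  refine ⟨?_, hγ.trans_le hmin, div_le_div₀ (by linarith) hmax hγ hmin⟩
  rw [isUnit_iff_ne_zero]
  intro hdet
  obtain ⟨v, hv, hv0⟩ := Matrix.exists_mulVec_eq_zero_iff.2 hdet
  have h := hlow v
  have hz : euclNorm (0 : Fin (2 ^ n) → ℝ) = 0 := by
    have := euclNorm_sq_eq (0 : Fin (2 ^ n) → ℝ)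
    simpa using this
  rw [hv0, hz] at h
  have hv1 : euclNorm v = 0 := by
    have := euclNorm_nonneg' v
    nlinarith
  apply hv
  have h5 := euclNorm_sq_eq v
  rw [hv1] at h5
  funext i
  have h6 := (Finset.sum_eq_zero_iff_of_nonneg (fun i _ => sq_nonneg (v i))).1
    (by rw [← h5]; norm_num) i (Finset.mem_univ i)
  simpa using h6
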